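/- The (r−1)-st exterior power Λ^{r−1}_{K[t]} M_φ of the abelian t-motive of a rank-r Drinfeld module φ(t) = θ + a_1τ + ... + a_rτ^r is an abelian t-motive, and its associated abelian t-module Λ^{r−1}φ = (G_a^{r−1}, φ_0) is given by φ_0(t) = θ·Id_{r−1} + E_1'τ + E_2'τ², where E_1' = (−1)^{r−1} times the matrix with first column (−a_{r−1}, ..., −a_2, −a_1)^T and superdiagonal-type entries a_r, and E_2' is the matrix with a_r in position (r−1,1) and zeros elsewhere. -/

import Mathlib

/-- The class of `v₁ ∧ ⋯ ∧ vₙ` in the `n`-th exterior power `⋀[R]^n M`. -/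
noncomputable def wedge {R M : Type*} [CommRing R] [AddCommGroup M] [Module R M] (n : ℕ)
    (v : Fin n → M) : ⋀[R]^n M :=
  ⟨ExteriorAlgebra.ιMulti R n v, ExteriorAlgebra.ιMulti_range R n (Set.mem_range_self v)⟩

/-- The semilinear `τ`-action on the abelian `t`-motive `M_φ` of
`φ(t) = θ + a₁τ + ⋯ + a_r τ^r`. -/
noncomputable def Tphi {K : Type*} [Field K] (φK : K →+* K) (θ : K) {r : ℕ} (a : ℕ → K)
    (v : Fin r → Polynomial K) : Fin r → Polynomial K :=
  fun i =>
    if (i : ℕ) = 0 then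
      (Polynomial.X - Polynomial.C θ) * Polynomial.C (a r)⁻¹ *
        (v ⟨r - 1, by have h := i.isLt; omega⟩).map φK
    else
      (v ⟨(i : ℕ) - 1, by have h := i.isLt; omega⟩).map φK -
        Polynomial.C (a (i : ℕ) * (a r)⁻¹) * (v ⟨r - 1, by have h := i.isLt; omega⟩).map φK

/-- The matrix `E₁' = (−1)^{r−1}·[first column (−a_{r−1},…,−a₁)ᵀ, superdiagonal a_r]`. -/
noncomputable def E1' {K : Type*} [Field K] (r : ℕ) (a : ℕ → K) :
    Matrix (Fin (r-1)) (Fin (r-1)) K :=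
  Matrix.of fun i j =>
    (-1 : K) ^ (r - 1) *
      (if (j : ℕ) = 0 then -(a (r - 1 - (i : ℕ)))
       else if (j : ℕ) = (i : ℕ) + 1 then a r else 0)

/-- The matrix `E₂'` with `a_r` in position `(r−1, 1)` and zeros elsewhere. -/
noncomputable def E2' {K : Type*} [Field K] (r : ℕ) (a : ℕ → K) :
    Matrix (Fin (r-1)) (Fin (r-1)) K :=
  Matrix.of fun i j => if (i : ℕ) = r - 2 ∧ (j : ℕ) = 0 then a r else 0

open Polynomial in
/-- A semilinear operator on `K[X]` raising the degree of every monomial by `d` raises the degree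
of every nonzero polynomial by `d`. -/
theorem Polynomial.degree_semilinear_apply {K : Type*} [Field K] (σ : K →+* K) (d : ℕ)
    (S : K[X] → K[X]) (hadd : ∀ p q, S (p + q) = S p + S q)
    (hsmul : ∀ (c : K) p, S (c • p) = σ c • S p)
    (hdeg : ∀ n : ℕ, (S (X ^ n)).degree = ((n + d : ℕ) : WithBot ℕ))
    {p : K[X]} {n : ℕ} (hp : p.degree = n) : (S p).degree = ((n + d : ℕ) : WithBot ℕ) := by
  induction n using Nat.strong_induction_on generalizing p with
  | _ n ih =>
    have hp0 : p ≠ 0 := by rintro rfl; simp at hp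
    have hn : p.natDegree = n := natDegree_eq_of_degree_eq_some hp
    have hlead : (S (p.leadingCoeff • X ^ n)).degree = ((n + d : ℕ) : WithBot ℕ) := by
      rw [hsmul, degree_smul_of_smul_regular _ (IsSMulRegular.of_ne_zero (by simpa using hp0)),
        hdeg]
    have hsplit : S p = S p.eraseLead + S (p.leadingCoeff • X ^ n) := by
      rw [← hadd, ← hn, smul_eq_C_mul, eraseLead_add_C_mul_X_pow]
    rw [hsplit]
    by_cases he : p.eraseLead = 0
    · have h0 : S 0 = 0 := by simpa using hadd 0 0
      rw [he, h0, zero_add, hlead]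
    · have hlt : p.eraseLead.natDegree < n := by
        have := degree_eraseLead_lt hp0
        rw [hp, degree_eq_natDegree he] at this
        exact_mod_cast this
      rw [degree_add_eq_right_of_degree_lt, hlead]
      rw [hlead, ih _ hlt (degree_eq_natDegree he)]
      exact_mod_cast Nat.add_lt_add_right hlt d

/-- The strictly increasing maps `Fin n → Fin (n + 1)` are the maps `Fin.succAbove i`. -/
noncomputable def succAbovePowersetCardEquiv (n : ℕ) :
    Fin (n + 1) ≃ Set.powersetCard (Fin (n + 1)) n :=
  Equiv.ofBijective (fun i => Set.powersetCard.ofFinEmbEquiv (Fin.succAboveOrderEmb i)) <| by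
    refine Function.Injective.bijective_of_nat_card_le ?_ ?_
    · intro i j h
      have h' := Set.powersetCard.ofFinEmbEquiv.injective h
      exact Fin.succAbove_left_injective (congrArg DFunLike.coe h')
    · rw [Set.powersetCard.card]
      simp

/-- The basis of `⋀^n R^(n+1)` given by the wedges of all but one of the standard vectors. -/
noncomputable def wedgeBasis (R : Type*) [CommRing R] (n : ℕ) :
    Module.Basis (Fin (n + 1)) R (⋀[R]^n (Fin (n + 1) → R)) :=
  ((Pi.basisFun R (Fin (n + 1))).exteriorPower n).reindex (succAbovePowersetCardEquiv n).symm

theorem wedgeBasis_apply (R : Type*) [CommRing R] (n : ℕ) (i : Fin (n + 1)) :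
    wedgeBasis R n i =
      exteriorPower.ιMulti R n (fun j => (Pi.single (i.succAbove j) 1 : Fin (n + 1) → R)) := by
  rw [wedgeBasis, Module.Basis.reindex_apply, exteriorPower.basis_apply,
    exteriorPower.ιMulti_family]
  congr 1
  ext1 j
  simp [succAbovePowersetCardEquiv]

theorem wedge_eq_ιMulti {R M : Type*} [CommRing R] [AddCommGroup M] [Module R M] (n : ℕ)
    (v : Fin n → M) : wedge n v = exteriorPower.ιMulti R n v := rfl

/-- Expansion of `w₀ ∧ ⋯ ∧ wₘ₋₁ ∧ x`, where the `wⱼ` are the standard vectors other than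
`e₀` and `e_{k+1}`. -/
theorem ιMulti_insertNth_last (R : Type*) [CommRing R] (m : ℕ) (k : Fin (m + 1))
    (u : R) (c : Fin (m + 1) → R) :
    exteriorPower.ιMulti R (m + 1) ((Fin.last m).insertNth
        (u • (Pi.single 0 1 : Fin (m + 2) → R) + ∑ j, c j • Pi.single j.succ 1)
        (fun j => Pi.single (k.succAbove j).succ 1)) =
      ((-1) ^ m * u) • wedgeBasis R (m + 1) k.succ +
        ((-1) ^ m * (-1) ^ (k : ℕ) * c k) • wedgeBasis R (m + 1) 0 := by
  set f := exteriorPower.ιMulti R (m + 1) (M := Fin (m + 2) → R)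
  set w : Fin m → Fin (m + 2) → R := fun j => Pi.single (k.succAbove j).succ 1 with hw
  have hzero : f (Matrix.vecCons (Pi.single 0 1) w) = wedgeBasis R (m + 1) k.succ := by
    rw [wedgeBasis_apply]
    congr 1
    ext1 j
    refine Fin.cases ?_ (fun j => ?_) j
    · simp
    · simp [hw]
  have hk : f (Matrix.vecCons (Pi.single k.succ 1) w) =
      ((-1 : R) ^ (k : ℕ)) • wedgeBasis R (m + 1) 0 := by
    have h : (-1) ^ (k : ℕ) • f (k.insertNth (Pi.single k.succ 1) w) =
        f (Matrix.vecCons (Pi.single k.succ 1) w) := by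
      rw [AlternatingMap.neg_one_pow_smul_map_insertNth]
    have h2 : k.insertNth (Pi.single k.succ 1) w =
        fun j => (Pi.single ((0 : Fin (m + 2)).succAbove j) 1 : Fin (m + 2) → R) := by
      ext1 j
      refine Fin.succAboveCases k ?_ (fun j => ?_) j
      · simp
      · simp [hw]
    rw [← h, h2, wedgeBasis_apply, ← Int.cast_smul_eq_zsmul R]
    push_cast
    rfl
  have hne : ∀ j, j ≠ k → f (Matrix.vecCons (Pi.single j.succ 1) w) = 0 := by
    intro j hj
    obtain ⟨j', rfl⟩ := Fin.exists_succAbove_eq hj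
    exact f.map_eq_zero_of_eq _ (i := 0) (j := j'.succ) (by simp [hw]) (by simp [Fin.ext_iff])
  let g : (Fin (m + 2) → R) →ₗ[R] ⋀[R]^(m + 1) (Fin (m + 2) → R) :=
    { toFun := fun x => f (Matrix.vecCons x w)
      map_add' := f.map_vecCons_add w
      map_smul' := f.map_vecCons_smul w }
  rw [AlternatingMap.map_insertNth, ← Int.cast_smul_eq_zsmul R]
  push_cast
  change _ • g _ = _
  have hg : g (u • Pi.single 0 1 + ∑ j, c j • Pi.single j.succ 1) =
      u • wedgeBasis R (m + 1) k.succ +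
        c k • ((-1 : R) ^ (k : ℕ)) • wedgeBasis R (m + 1) 0 := by
    rw [map_add, map_sum, Finset.sum_eq_single k, map_smul, map_smul, ← hzero, ← hk]
    · rfl
    · intro j _ hj
      rw [map_smul]
      exact (congrArg _ (hne j hj)).trans (smul_zero _)
    · simp
  rw [hg]
  module

section Tphi

open Polynomial

variable {K : Type*} [Field K] (σ : K →+* K) (θ : K) (a : ℕ → K) (m : ℕ)

theorem Tphi_apply_zero (v : Fin (m + 2) → K[X]) :
    Tphi σ θ a v 0 = (X - C θ) * C (a (m + 2))⁻¹ * (v (Fin.last (m + 1))).map σ :=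
  if_pos rfl

theorem Tphi_apply_succ (v : Fin (m + 2) → K[X]) (i : Fin (m + 1)) :
    Tphi σ θ a v i.succ = (v i.castSucc).map σ -
      C (a (i + 1) * (a (m + 2))⁻¹) * (v (Fin.last (m + 1))).map σ :=
  if_neg (Nat.succ_ne_zero _)

theorem Tphi_single_castSucc (j : Fin (m + 1)) :
    Tphi σ θ a (Pi.single j.castSucc 1 : Fin (m + 2) → K[X]) = Pi.single j.succ 1 := by
  have hj : Fin.last (m + 1) ≠ j.castSucc := (Fin.castSucc_lt_last j).ne'
  ext1 i
  refine Fin.cases ?_ (fun i => ?_) i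
  · rw [Tphi_apply_zero, Pi.single_eq_of_ne hj, Pi.single_eq_of_ne (Fin.succ_ne_zero j).symm]
    simp
  · rw [Tphi_apply_succ, Pi.single_eq_of_ne hj]
    by_cases h : i = j
    · simp [h]
    · simp [h]

theorem Tphi_single_last :
    Tphi σ θ a (Pi.single (Fin.last (m + 1)) 1 : Fin (m + 2) → K[X]) =
      ((X - C θ) * C (a (m + 2))⁻¹) • Pi.single 0 1 +
        ∑ j : Fin (m + 1), (-C (a (j + 1) * (a (m + 2))⁻¹)) • Pi.single j.succ 1 := by
  ext1 i
  refine Fin.cases ?_ (fun i => ?_) i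
  · rw [Tphi_apply_zero]
    simp [Finset.sum_apply]
  · rw [Tphi_apply_succ]
    simp [Finset.sum_apply, Pi.single_apply]

variable {σ θ a m}

theorem wedge_Tphi_last :
    wedge (m + 1) (fun j => Tphi σ θ a
      (Pi.single ((Fin.last (m + 1)).succAbove j) 1 : Fin (m + 2) → K[X])) =
      wedgeBasis K[X] (m + 1) 0 := by
  rw [wedgeBasis_apply, wedge_eq_ιMulti]
  simp [Tphi_single_castSucc]

theorem wedge_Tphi_castSucc (k : Fin (m + 1)) :
    wedge (m + 1) (fun j => Tphi σ θ a
      (Pi.single (k.castSucc.succAbove j) 1 : Fin (m + 2) → K[X])) =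
      ((-1) ^ m * ((X - C θ) * C (a (m + 2))⁻¹)) • wedgeBasis K[X] (m + 1) k.succ +
        ((-1) ^ m * (-1) ^ (k : ℕ) * -C (a (k + 1) * (a (m + 2))⁻¹)) •
          wedgeBasis K[X] (m + 1) 0 := by
  rw [← ιMulti_insertNth_last _ _ _ _ fun j => -C (a (j + 1) * (a (m + 2))⁻¹), wedge_eq_ιMulti]
  congr 1
  ext1 j
  refine Fin.lastCases ?_ (fun j => ?_) j
  · have : k.castSucc.succAbove (Fin.last m) = Fin.last (m + 1) := by
      rw [Fin.succAbove_of_le_castSucc _ _ (by simpa using Fin.le_last k), Fin.succ_last]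
    rw [this, Tphi_single_last, Fin.insertNth_apply_same]
  · have : k.castSucc.succAbove j.castSucc = (k.succAbove j).castSucc := by simp
    rw [this, Tphi_single_castSucc, Fin.insertNth_last', Fin.snoc_castSucc]

end Tphi

section Weight

open Polynomial

variable {K M : Type*} [Field K] [AddCommGroup M] [Module K M]

/-- If `T` raises a degree function by `d` and `v i` has degree `i` for `i < d`, then the iterates
of `T` on the `v i` form a `K`-basis. -/
theorem basis_iterate_of_degree (σ : K →+* K) (d : ℕ) [NeZero d] (L : M ≃ₗ[K] K[X]) (T : M → M)
    (hadd : ∀ x y, T (x + y) = T x + T y) (hsmul : ∀ (c : K) x, T (c • x) = σ c • T x)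
    (hdeg : ∀ n : ℕ, (L (T (L.symm (X ^ n)))).degree = ((n + d : ℕ) : WithBot ℕ))
    (v : Fin d → M) (hv : ∀ i, (L (v i)).degree = ((i : ℕ) : WithBot ℕ)) :
    LinearIndependent K (fun pr : ℕ × Fin d => T^[pr.1] (v pr.2)) ∧
      ⊤ ≤ Submodule.span K (Set.range (fun pr : ℕ × Fin d => T^[pr.1] (v pr.2))) := by
  have hstep : ∀ (x : M) (n : ℕ), (L x).degree = n →
      (L (T x)).degree = ((n + d : ℕ) : WithBot ℕ) := by
    intro x n hx
    have := degree_semilinear_apply σ d (fun p => L (T (L.symm p))) (by simp [hadd])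
      (by simp [hsmul]) hdeg hx
    simpa using this
  have hiter : ∀ (k : ℕ) (i : Fin d),
      (L (T^[k] (v i))).degree = ((k * d + i : ℕ) : WithBot ℕ) := by
    intro k i
    induction k with
    | zero => simpa using hv i
    | succ k ih =>
      rw [Function.iterate_succ_apply', hstep _ _ ih]
      congr 1
      ring
  let e := Nat.divModEquiv d
  let S : Polynomial.Sequence K :=
    { elems' := fun n => L (T^[(e n).1] (v (e n).2))
      degree_eq' := fun n => by
        rw [hiter]
        congr 1
        exact e.symm_apply_apply n }
  let b :=
    ((S.basis fun n => (leadingCoeff_ne_zero.mpr (S.ne_zero n)).isUnit).map L.symm).reindex e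
  have hb : (fun pr : ℕ × Fin d => T^[pr.1] (v pr.2)) = b := by
    ext1 pr
    simp [b, S]
  rw [hb]
  exact ⟨b.linearIndependent, b.span_eq.ge⟩

variable [Module K[X] M] [IsScalarTower K K[X] M] {r : ℕ} [NeZero r]

/-- The `K`-linear identification of a free `K[t]`-module of rank `r` with a polynomial ring in
one variable, sending `t ^ k • B i` to the monomial of degree `r * k + (r - 1 - i)`. -/
noncomputable def weightEquiv (B : Module.Basis (Fin r) K[X] M) : M ≃ₗ[K] K[X] :=
  (((basisMonomials K).smulTower B).reindex
    (((Equiv.refl ℕ).prodCongr Fin.revPerm).trans (Nat.divModEquiv r).symm)).repr ≪≫ₗ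
    (basisMonomials K).repr.symm

theorem weightEquiv_X_pow_smul (B : Module.Basis (Fin r) K[X] M) (k : ℕ) (i : Fin r) :
    weightEquiv B ((X : K[X]) ^ k • B i) = X ^ (k * r + i.rev) := by
  have h : (X : K[X]) ^ k • B i = ((basisMonomials K).smulTower B).reindex
      (((Equiv.refl ℕ).prodCongr Fin.revPerm).trans (Nat.divModEquiv r).symm)
      (k * r + i.rev) := by
    have h2 : (k * r + i.rev : ℕ) =
        (((Equiv.refl ℕ).prodCongr Fin.revPerm).trans (Nat.divModEquiv r).symm) (k, i) := rfl
    rw [h2, Module.Basis.reindex_apply, Equiv.symm_apply_apply, Module.Basis.smulTower_apply,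
      coe_basisMonomials, X_pow_eq_monomial]
  rw [weightEquiv, LinearEquiv.trans_apply, h, Module.Basis.repr_self,
    Module.Basis.repr_symm_single, one_smul, coe_basisMonomials, X_pow_eq_monomial]

theorem weightEquiv_smul (B : Module.Basis (Fin r) K[X] M) (p : K[X]) (i : Fin r) :
    weightEquiv B (p • B i) = expand K r p * X ^ (i.rev : ℕ) := by
  induction p using Polynomial.induction_on' with
  | add p q hp hq => rw [add_smul, map_add, hp, hq, map_add, add_mul]
  | monomial n c =>
    rw [← C_mul_X_pow_eq_monomial, ← smul_eq_C_mul, smul_assoc, map_smul, weightEquiv_X_pow_smul,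
      map_smul, map_pow, expand_X, smul_mul_assoc, ← pow_mul, ← pow_add, mul_comm r]

theorem weightEquiv_symm_X_pow (B : Module.Basis (Fin r) K[X] M) (k : ℕ) (i : Fin r) :
    (weightEquiv B).symm (X ^ (k * r + i.rev)) = (X : K[X]) ^ k • B i := by
  rw [← weightEquiv_X_pow_smul B, LinearEquiv.symm_apply_apply]

end Weight

section ExteriorPower

open Polynomial

variable {K : Type*} [Field K] {σ : K →+* K} {θ : K} {a : ℕ → K} {m : ℕ}

/-- The `K[τ]`-basis of `⋀^(r-1) M_φ`, up to sign the elements `e₀ ∧ ⋯ ∧ êₗ ∧ ⋯ ∧ e_{r-1}`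
with `l ≠ 0` in decreasing order of `l`. -/
noncomputable def tauBasis (K : Type*) [Field K] (m : ℕ) (i : Fin (m + 1)) :
    ⋀[K[X]]^(m + 1) (Fin (m + 2) → K[X]) :=
  ((-1 : K[X]) ^ (i : ℕ)) • wedgeBasis K[X] (m + 1) i.rev.succ

theorem degree_weightEquiv_tauBasis (i : Fin (m + 1)) :
    (weightEquiv (wedgeBasis K[X] (m + 1)) (tauBasis K m i)).degree = ((i : ℕ) : WithBot ℕ) := by
  rw [tauBasis, weightEquiv_smul, Fin.rev_succ, Fin.rev_rev, Fin.val_castSucc]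
  rcases neg_one_pow_eq_or K[X] (i : ℕ) with h | h <;> simp [h]

theorem degree_weightEquiv_tau_castSucc (har : a (m + 2) ≠ 0) (k : ℕ) (i : Fin (m + 1)) :
    (weightEquiv (wedgeBasis K[X] (m + 1)) ((X : K[X]) ^ k •
      (((-1) ^ m * ((X - C θ) * C (a (m + 2))⁻¹)) • wedgeBasis K[X] (m + 1) i.succ +
        ((-1) ^ m * (-1) ^ (i : ℕ) * -C (a (i + 1) * (a (m + 2))⁻¹)) •
          wedgeBasis K[X] (m + 1) 0))).degree =
      ((k * (m + 2) + i.castSucc.rev + (m + 1) : ℕ) : WithBot ℕ) := by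
  rw [smul_add, smul_smul, smul_smul, map_add, weightEquiv_smul, weightEquiv_smul]
  simp only [map_mul, map_pow, map_neg, map_one, map_sub, expand_X, expand_C]
  have hi := i.isLt
  have hd : ((X ^ (m + 2)) ^ k * ((-1) ^ m * ((X ^ (m + 2) - C θ) * C (a (m + 2))⁻¹)) *
      X ^ (i.succ.rev : ℕ) : K[X]).degree =
      ((k * (m + 2) + i.castSucc.rev + (m + 1) : ℕ) : WithBot ℕ) := by
    have h1 : ((-1 : K[X]) ^ m).degree = 0 := by
      rcases neg_one_pow_eq_or K[X] m with h | h <;> simp [h]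
    rw [degree_mul, degree_mul, degree_mul, degree_mul, h1, degree_X_pow_sub_C (by omega),
      degree_C (inv_ne_zero har), ← pow_mul, degree_X_pow, degree_X_pow, Fin.val_rev, Fin.val_rev]
    norm_cast
    simp only [Fin.val_succ, Fin.val_castSucc, zero_add, add_zero]
    rw [mul_comm]
    omega
  rw [degree_add_eq_left_of_degree_lt, hd]
  rw [hd]
  have hs : ((X ^ (m + 2)) ^ k * ((-1) ^ m * (-1) ^ (i : ℕ) *
      -(C (a (i + 1)) * C (a (m + 2))⁻¹)) * X ^ ((0 : Fin (m + 2)).rev : ℕ) : K[X]) =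
      C ((-1) ^ m * (-1) ^ (i : ℕ) * -(a (i + 1) * (a (m + 2))⁻¹)) *
        X ^ (k * (m + 2) + (m + 1)) := by
    simp only [map_mul, map_pow, map_neg, map_one, Fin.val_rev, Fin.val_zero]
    rw [show m + 2 - (0 + 1) = m + 1 by omega]
    ring
  rw [hs]
  refine (degree_C_mul_X_pow_le _ _).trans_lt ?_
  norm_cast
  simp only [Fin.val_rev, Fin.val_castSucc]
  omega

theorem degree_weightEquiv_tau
    (τΛ : ⋀[K[X]]^(m + 1) (Fin (m + 2) → K[X]) → ⋀[K[X]]^(m + 1) (Fin (m + 2) → K[X]))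
    (hsmul : ∀ (f : K[X]) x, τΛ (f • x) = (f.map σ) • τΛ x)
    (hτ : ∀ w : Fin (m + 1) → (Fin (m + 2) → K[X]),
      τΛ (wedge (m + 1) w) = wedge (m + 1) (fun i => Tphi σ θ a (w i)))
    (har : a (m + 2) ≠ 0) (n : ℕ) :
    (weightEquiv (wedgeBasis K[X] (m + 1))
      (τΛ ((weightEquiv (wedgeBasis K[X] (m + 1))).symm (X ^ n)))).degree =
      ((n + (m + 1) : ℕ) : WithBot ℕ) := by
  obtain ⟨⟨k, i'⟩, rfl⟩ := (Nat.divModEquiv (m + 2)).symm.surjective n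
  obtain ⟨i, rfl⟩ := Fin.rev_surjective i'
  change (weightEquiv _ (τΛ ((weightEquiv _).symm (X ^ (k * (m + 2) + i.rev))))).degree =
    ((k * (m + 2) + i.rev + (m + 1) : ℕ) : WithBot ℕ)
  rw [weightEquiv_symm_X_pow, hsmul, Polynomial.map_pow, map_X, wedgeBasis_apply,
    ← wedge_eq_ιMulti, hτ]
  refine Fin.lastCases ?_ (fun i => ?_) i
  · rw [wedge_Tphi_last, weightEquiv_X_pow_smul, degree_X_pow]
    simp [add_assoc, one_add_one_eq_two]
  · rw [wedge_Tphi_castSucc, degree_weightEquiv_tau_castSucc har]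

/-- The relations `(t - θ) • b_{k+1} = (-1)^m a_r T(b_k) + (-1)^k a_{k+1} b₀` and `T(b_{r-1}) = b₀`,
rewritten in terms of the `v i = (-1)^i • b_{r-1-i}`. -/
theorem X_smul_eq_of_relations {N : Type*} [AddCommGroup N] [Module K[X] N] (T : N → N)
    (b : Fin (m + 2) → N) (v : Fin (m + 1) → N)
    (hv : ∀ i, v i = ((-1 : K[X]) ^ (i : ℕ)) • b i.rev.succ)
    (hTv : ∀ i, T (v i) = ((-1 : K[X]) ^ (i : ℕ)) • T (b i.rev.succ))
    (hlast : T (b (Fin.last (m + 1))) = b 0)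
    (hcast : ∀ k : Fin (m + 1), (X - C θ) • b k.succ =
      ((-1) ^ m * C (a (m + 2))) • T (b k.castSucc) + ((-1) ^ (k : ℕ) * C (a (k + 1))) • b 0)
    (i : Fin (m + 1)) :
    (X : K[X]) • v i = C θ • v i +
      ∑ j : Fin (m + 1), C ((-1) ^ (m + 1) * if (j : ℕ) = 0 then -a (m + 1 - i) else
        if (j : ℕ) = i + 1 then a (m + 2) else 0) • T (v j) +
      ∑ j : Fin (m + 1), C (if (i : ℕ) = m ∧ (j : ℕ) = 0 then a (m + 2) else 0) •
        T (T (v j)) := by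
  have hv0 : T (v 0) = b 0 := by
    rw [hTv, Fin.rev_zero, Fin.succ_last, hlast]
    simp
  have hsplit : (X : K[X]) • v i = C θ • v i +
      ((-1 : K[X]) ^ (i : ℕ)) • (X - C θ) • b i.rev.succ := by
    rw [hv]
    module
  have hE2 : ∑ j : Fin (m + 1), C (if (i : ℕ) = m ∧ (j : ℕ) = 0 then a (m + 2) else 0) •
        T (T (v j)) = C (if (i : ℕ) = m then a (m + 2) else 0) • T (b 0) := by
    rw [Fin.sum_univ_succ, hv0]
    simp
  have hidx : m + 1 - (i : ℕ) = i.rev + 1 := by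
    rw [Fin.val_rev]
    omega
  have hs : ∀ c : K[X], (-1) ^ (i : ℕ) * ((-1) ^ (i.rev : ℕ) * c) = (-1) ^ m * c := fun c => by
    rw [← mul_assoc, ← pow_add, Fin.val_rev]
    congr 2
    omega
  have hsq : ∀ k : ℕ, ((-1 : K[X]) ^ k) * (-1) ^ k = 1 := fun k => by rw [← mul_pow]; simp
  rw [hsplit, hcast, hE2, Fin.sum_univ_succ, hv0, hidx, smul_add, smul_smul, smul_smul,
    hs]
  simp only [Fin.val_zero, if_true, Fin.val_succ, Nat.succ_ne_zero, if_false,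
    Nat.add_right_cancel_iff]
  rcases Fin.eq_castSucc_or_eq_last i with ⟨i, rfl⟩ | rfl
  · have hb : T (v i.succ) = ((-1 : K[X]) ^ ((i : ℕ) + 1)) • T (b i.castSucc.rev.castSucc) := by
      rw [hTv, Fin.rev_succ, Fin.succ_castSucc, Fin.rev_castSucc, Fin.val_succ]
    rw [Finset.sum_eq_single i, hb]
    · simp only [Fin.val_castSucc, if_true, i.isLt.ne, if_false, map_mul, map_pow, map_neg,
        map_one, map_zero]
      module
    · intro j _ hj
      simp [Fin.val_ne_of_ne hj]
    · simp
  · rw [Finset.sum_eq_zero fun j _ => by simp [j.isLt.ne]]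
    simp only [Fin.rev_last, Fin.val_zero, Fin.val_last, if_true, map_mul, map_pow, map_neg,
      map_one, Fin.castSucc_zero]
    rw [← mul_assoc, hsq]
    module

theorem X_smul_tauBasis
    (τΛ : ⋀[K[X]]^(m + 1) (Fin (m + 2) → K[X]) → ⋀[K[X]]^(m + 1) (Fin (m + 2) → K[X]))
    (hsmul : ∀ (f : K[X]) x, τΛ (f • x) = (f.map σ) • τΛ x)
    (hτ : ∀ w : Fin (m + 1) → (Fin (m + 2) → K[X]),
      τΛ (wedge (m + 1) w) = wedge (m + 1) (fun i => Tphi σ θ a (w i)))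
    (har : a (m + 2) ≠ 0) (i : Fin (m + 1)) :
    (X : K[X]) • tauBasis K m i = C θ • tauBasis K m i +
      ∑ j : Fin (m + 1), C ((-1) ^ (m + 1) * if (j : ℕ) = 0 then -a (m + 1 - i) else
        if (j : ℕ) = i + 1 then a (m + 2) else 0) • τΛ (tauBasis K m j) +
      ∑ j : Fin (m + 1), C (if (i : ℕ) = m ∧ (j : ℕ) = 0 then a (m + 2) else 0) •
        τΛ (τΛ (tauBasis K m j)) := by
  refine X_smul_eq_of_relations τΛ (wedgeBasis K[X] (m + 1)) (tauBasis K m) (fun _ => rfl)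
    (fun j => ?_) ?_ (fun k => ?_) i
  · rw [tauBasis, hsmul, Polynomial.map_pow, Polynomial.map_neg, Polynomial.map_one]
  · rw [wedgeBasis_apply, ← wedge_eq_ιMulti, hτ, wedge_Tphi_last]
  · rw [wedgeBasis_apply _ _ k.castSucc, ← wedge_eq_ιMulti, hτ, wedge_Tphi_castSucc]
    have h1 : ((-1 : K[X]) ^ m) * (-1) ^ m = 1 := by rw [← mul_pow]; simp
    have h2 : (C (a (m + 2)) : K[X]) * C (a (m + 2))⁻¹ = 1 := by
      rw [← C_mul, mul_inv_cancel₀ har, C_1]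
    rw [C_mul, smul_add, smul_smul, smul_smul]
    have h3 : (-1) ^ m * C (a (m + 2)) * ((-1) ^ m * ((X - C θ) * C (a (m + 2))⁻¹)) =
        (X - C θ : K[X]) := by
      linear_combination (X - C θ) * (C (a (m + 2)) * C (a (m + 2))⁻¹) * h1 + (X - C θ) * h2
    have h4 : (-1) ^ m * C (a (m + 2)) * ((-1) ^ m * (-1) ^ (k : ℕ) *
        -(C (a (k + 1)) * C (a (m + 2))⁻¹)) = -((-1) ^ (k : ℕ) * C (a (k + 1)) : K[X]) := by
      linear_combination -(-1) ^ (k : ℕ) * C (a (k + 1)) *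
        (C (a (m + 2)) * C (a (m + 2))⁻¹ * h1 + h2)
    rw [h3, h4]
    module

end ExteriorPower
/-- The `(r−1)`-st exterior power `⋀^{r−1}_{K[t]} M_φ` of the abelian `t`-motive of
a rank-`r` Drinfeld module `φ(t) = θ + a₁τ + ⋯ + a_r τ^r` is an abelian
`t`-motive: it is free and finitely generated over `K[τ]` — i.e. there are
elements `v₁,…,v_{r−1}` such that the `τ`-iterates `τ^k(vᵢ)` form a `K`-basis —
and its associated abelian `t`-module `⋀^{r−1}φ = (𝔾_a^{r−1}, φ₀)` is given by
`φ₀(t) = θ·Id_{r−1} + E₁'τ + E₂'τ²`, i.e.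
`t • vᵢ = θ vᵢ + Σⱼ (E₁')ᵢⱼ τ(vⱼ) + Σⱼ (E₂')ᵢⱼ τ²(vⱼ)`. -/
theorem stmt9 {K Fq : Type*} [Field K] [Field Fq] [Fintype Fq] [Algebra Fq K]
    (φK : K →+* K) (hφK : ∀ x : K, φK x = x ^ Fintype.card Fq)
    (θ : K) (hθ : Transcendental Fq θ)
    (r : ℕ) (hr : 2 ≤ r) (a : ℕ → K) (har : a r ≠ 0) :
    ∃ v : Fin (r-1) → ⋀[Polynomial K]^(r-1) (Fin r → Polynomial K),
      ∀ τΛ : (⋀[Polynomial K]^(r-1) (Fin r → Polynomial K)) →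
             (⋀[Polynomial K]^(r-1) (Fin r → Polynomial K)),
        (∀ x y, τΛ (x + y) = τΛ x + τΛ y) →
        (∀ (f : Polynomial K) x, τΛ (f • x) = (f.map φK) • τΛ x) →
        (∀ w : Fin (r-1) → (Fin r → Polynomial K),
            τΛ (wedge (r-1) w) = wedge (r-1) (fun i => Tphi φK θ a (w i))) →
        -- ⋀^{r−1} M_φ is free over K[τ] with basis v₁,…,v_{r−1}
        (LinearIndependent K (fun pr : ℕ × Fin (r-1) => τΛ^[pr.1] (v pr.2)) ∧
         ⊤ ≤ Submodule.span K (Set.range (fun pr : ℕ × Fin (r-1) => τΛ^[pr.1] (v pr.2)))) ∧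
        -- the t-action is given by φ₀(t) = θ·Id + E₁'τ + E₂'τ²
        (∀ i : Fin (r-1),
          (Polynomial.X : Polynomial K) • v i =
            Polynomial.C θ • v i +
              ∑ j : Fin (r-1), Polynomial.C (E1' r a i j) • τΛ (v j) +
              ∑ j : Fin (r-1), Polynomial.C (E2' r a i j) • τΛ (τΛ (v j))) := by
  obtain ⟨m, rfl⟩ := Nat.exists_eq_add_of_le' hr
  refine ⟨tauBasis K m, fun τΛ hadd hsmul hτ => ⟨?_, X_smul_tauBasis τΛ hsmul hτ har⟩⟩
  refine basis_iterate_of_degree φK (m + 1) (weightEquiv (wedgeBasis (Polynomial K) (m + 1))) τΛ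
    hadd (fun c x => ?_) (degree_weightEquiv_tau τΛ hsmul hτ har) (tauBasis K m)
    degree_weightEquiv_tauBasis
  rw [← algebraMap_smul (Polynomial K) c x, ← algebraMap_smul (Polynomial K) (φK c)]
  exact (hsmul (Polynomial.C c) x).trans (by rw [Polynomial.map_C]; rfl)
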